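/- Let d ≥ 1 and let n, f, m be integers with f ≥ 0, n > 2f, and 1 ≤ m ≤ n−f. For all vectors x_1,…,x_n ∈ ℝ^d, every neighbor selection N with associated score s, every m-MultiKrum selection S*_m, and every set S ⊆ {1,…,n} with |S| = n−f, letting u = |S*_m ∖ S| and v = |S*_m ∩ S|, one has ‖x̄_{S*_m} − x̄_S‖² ≤ ((n−f)/m²) · ( √v + (√(2m) + √u) · √(u/(n−2f)) )² · Σ_S. -/

import Mathlib

open Finset

/-- Mean of the vectors indexed by a finite set `A`. -/
noncomputable def meanVec {d n : ℕ} (x : Fin n → EuclideanSpace ℝ (Fin d))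
    (A : Finset (Fin n)) : EuclideanSpace ℝ (Fin d) :=
  (A.card : ℝ)⁻¹ • ∑ i ∈ A, x i

/-- Empirical variance of the vectors indexed by a finite set `A`. -/
noncomputable def varVec {d n : ℕ} (x : Fin n → EuclideanSpace ℝ (Fin d))
    (A : Finset (Fin n)) : ℝ :=
  (A.card : ℝ)⁻¹ * ∑ i ∈ A, ‖x i - meanVec x A‖ ^ 2

/-- `N` is a neighbor selection: `N y` consists of `n - f` indices of points
closest to `y` among `x 1, …, x n`. -/
def IsNbhdSel {d n : ℕ} (f : ℕ) (x : Fin n → EuclideanSpace ℝ (Fin d))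
    (N : EuclideanSpace ℝ (Fin d) → Finset (Fin n)) : Prop :=
  ∀ y, (N y).card = n - f ∧ ∀ i ∈ N y, ∀ j ∉ N y, ‖y - x i‖ ≤ ‖y - x j‖

/-- The score associated to a neighbor selection `N`. -/
noncomputable def score {d n : ℕ} (f : ℕ) (x : Fin n → EuclideanSpace ℝ (Fin d))
    (N : EuclideanSpace ℝ (Fin d) → Finset (Fin n))
    (y : EuclideanSpace ℝ (Fin d)) : ℝ :=
  ((n : ℝ) - (f : ℝ))⁻¹ * ∑ i ∈ N y, ‖y - x i‖ ^ 2

/-- `Sm` is an `m`-MultiKrum selection with respect to the score `s`: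
it consists of `m` indices whose points have the smallest scores. -/
def IsMultiKrumSel {d n : ℕ} (m : ℕ) (x : Fin n → EuclideanSpace ℝ (Fin d))
    (s : EuclideanSpace ℝ (Fin d) → ℝ) (Sm : Finset (Fin n)) : Prop :=
  Sm.card = m ∧ ∀ i ∈ Sm, ∀ j ∉ Sm, s (x i) ≤ s (x j)

/-- Averages over a set of smallest values. -/
lemma mk_avg_le {ι : Type*} [DecidableEq ι] (h : ι → ℝ) (A B : Finset ι)
    (hc : A.card ≤ B.card) (hAB : ∀ i ∈ A, ∀ j ∉ A, h i ≤ h j) :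
    (B.card : ℝ) * ∑ i ∈ A, h i ≤ A.card * ∑ i ∈ B, h i := by
  rcases A.eq_empty_or_nonempty with rfl | hne
  · simp
  obtain ⟨k, hk, hmax⟩ := A.exists_max_image h hne
  have e1 : ∑ i ∈ A ∩ B, h i + ∑ i ∈ A \ B, h i = ∑ i ∈ A, h i :=
    Finset.sum_inter_add_sum_sdiff A B h
  have e2 : ∑ i ∈ B ∩ A, h i + ∑ i ∈ B \ A, h i = ∑ i ∈ B, h i :=
    Finset.sum_inter_add_sum_sdiff B A h
  rw [Finset.inter_comm] at e2
  have c1 : ((A ∩ B).card : ℝ) + (A \ B).card = A.card := by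
    exact_mod_cast Finset.card_inter_add_card_sdiff A B
  have c2 : ((A ∩ B).card : ℝ) + (B \ A).card = B.card := by
    rw [Finset.inter_comm]
    exact_mod_cast Finset.card_inter_add_card_sdiff B A
  have b1 : ∑ i ∈ A ∩ B, h i ≤ (A ∩ B).card * h k := by
    rw [← nsmul_eq_mul]
    exact Finset.sum_le_card_nsmul _ _ _ fun i hi => hmax i (Finset.mem_inter.1 hi).1
  have b2 : ∑ i ∈ A \ B, h i ≤ (A \ B).card * h k := by
    rw [← nsmul_eq_mul]
    exact Finset.sum_le_card_nsmul _ _ _ fun i hi => hmax i (Finset.mem_sdiff.1 hi).1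
  have b3 : (B \ A).card * h k ≤ ∑ i ∈ B \ A, h i := by
    rw [← nsmul_eq_mul]
    exact Finset.card_nsmul_le_sum _ _ _ fun i hi => hAB k hk i (Finset.mem_sdiff.1 hi).2
  have hc' : (0 : ℝ) ≤ (B.card : ℝ) - A.card := by
    have : (A.card : ℝ) ≤ B.card := by exact_mod_cast hc
    linarith
  have p1 := mul_le_mul_of_nonneg_left b1 hc'
  have p2 := mul_le_mul_of_nonneg_left b2 (Nat.cast_nonneg (α := ℝ) B.card)
  have p3 := mul_le_mul_of_nonneg_left b3 (Nat.cast_nonneg (α := ℝ) A.card)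
  rw [← e1, ← e2]
  have key : ((B.card : ℝ) - A.card) * ((A ∩ B).card * h k) + B.card * ((A \ B).card * h k)
      = A.card * ((B \ A).card * h k) := by
    rw [← c1, ← c2]; ring
  linarith

lemma mk_cs {ι : Type*} (T : Finset ι) (a : ι → ℝ) :
    ∑ i ∈ T, a i ≤ √(T.card : ℝ) * √(∑ i ∈ T, a i ^ 2) := by
  rw [← Real.sqrt_mul (Nat.cast_nonneg _)]
  exact Real.le_sqrt_of_sq_le sq_sum_le_card_mul_sum_sq

lemma mk_sum_sub {d n : ℕ} (x : Fin n → EuclideanSpace ℝ (Fin d)) (S : Finset (Fin n))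
    (h : S.Nonempty) : ∑ i ∈ S, (x i - meanVec x S) = 0 := by
  have : (S.card : ℝ) ≠ 0 := by exact_mod_cast h.card_pos.ne'
  rw [Finset.sum_sub_distrib, Finset.sum_const, meanVec, ← Nat.cast_smul_eq_nsmul ℝ, smul_smul,
    mul_inv_cancel₀ this, one_smul, sub_self]

lemma mk_pair {d n : ℕ} (y : Fin n → EuclideanSpace ℝ (Fin d)) (S : Finset (Fin n))
    (h : ∑ i ∈ S, y i = 0) :
    ∑ i ∈ S, ∑ j ∈ S, ‖y i - y j‖ ^ 2 = 2 * S.card * ∑ i ∈ S, ‖y i‖ ^ 2 := by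
  have : ∀ i, ∑ j ∈ S, ‖y i - y j‖ ^ 2 = S.card * ‖y i‖ ^ 2 + ∑ j ∈ S, ‖y j‖ ^ 2 := by
    intro i
    simp_rw [norm_sub_sq_real]
    rw [Finset.sum_add_distrib, Finset.sum_sub_distrib, ← Finset.mul_sum, ← inner_sum, h]
    simp
  simp_rw [this]
  rw [Finset.sum_add_distrib, ← Finset.mul_sum]
  simp
  ring

theorem multikrum_per_instance_bound {d : ℕ} (hd : 1 ≤ d) (n f m : ℕ)
    (hn : 2 * f < n) (hm1 : 1 ≤ m) (hm2 : m ≤ n - f)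
    (x : Fin n → EuclideanSpace ℝ (Fin d))
    (N : EuclideanSpace ℝ (Fin d) → Finset (Fin n)) (hN : IsNbhdSel f x N)
    (Sm : Finset (Fin n)) (hSm : IsMultiKrumSel m x (score f x N) Sm)
    (S : Finset (Fin n)) (hS : S.card = n - f) :
    ‖meanVec x Sm - meanVec x S‖ ^ 2 ≤
      (((n : ℝ) - f) / (m : ℝ) ^ 2) *
        (Real.sqrt ((Sm ∩ S).card : ℝ)
          + (Real.sqrt (2 * m) + Real.sqrt ((Sm \ S).card : ℝ))
            * Real.sqrt (((Sm \ S).card : ℝ) / ((n : ℝ) - 2 * f))) ^ 2 *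
        varVec x S := by
  obtain ⟨hcard, hsel⟩ := hSm
  have hSne : S.Nonempty := Finset.card_pos.1 (by omega)
  have hg : (S.card : ℝ) = (n : ℝ) - f := by rw [hS, Nat.cast_sub (by omega)]
  have hgpos : (0 : ℝ) < S.card := by exact_mod_cast hSne.card_pos
  have hmpos : (0 : ℝ) < m := by exact_mod_cast hm1
  have hq : (0 : ℝ) < (n : ℝ) - 2 * f := by
    have : ((2 * f : ℕ) : ℝ) < n := by exact_mod_cast hn
    push_cast at this; linarith
  set c := meanVec x S with hcdef
  set q : ℝ := (n : ℝ) - 2 * f with hqdef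
  set V : ℝ := ∑ i ∈ S, ‖x i - c‖ ^ 2 with hV
  have hV0 : 0 ≤ V := Finset.sum_nonneg fun _ _ => by positivity
  have hvar : varVec x S = (S.card : ℝ)⁻¹ * V := rfl
  have hsum0 : ∑ i ∈ S, (x i - c) = 0 := mk_sum_sub x S hSne
  set P : Fin n → ℝ := fun i => ∑ j ∈ N (x i), ‖x i - x j‖ ^ 2 with hP
  have hP0 : ∀ i, 0 ≤ P i := fun i => Finset.sum_nonneg fun _ _ => by positivity
  have hsc : ∀ i, score f x N (x i) = (S.card : ℝ)⁻¹ * P i := by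
    intro i; rw [hg]; rfl
  -- the score at `x i` is at most the average over `S`
  have hPS : ∀ i, P i ≤ ∑ j ∈ S, ‖x i - x j‖ ^ 2 := by
    intro i
    obtain ⟨h1, h2⟩ := hN (x i)
    have := mk_avg_le (fun j => ‖x i - x j‖ ^ 2) (N (x i)) S (by omega)
      (fun a ha b hb => pow_le_pow_left₀ (norm_nonneg _) (h2 a ha b hb) 2)
    rw [h1, ← hS] at this
    exact le_of_mul_le_mul_left this hgpos
  have hPtot : ∑ i ∈ S, P i ≤ 2 * S.card * V := by
    have := mk_pair (fun i => x i - c) S hsum0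
    simp only [sub_sub_sub_cancel_right] at this
    rw [hV, ← this]
    exact Finset.sum_le_sum fun i _ => hPS i
  have hPSm : ∑ i ∈ Sm, P i ≤ 2 * m * V := by
    have := mk_avg_le P Sm S (by omega) (fun a ha b hb => by
      have := hsel a ha b hb
      rw [hsc, hsc] at this
      exact le_of_mul_le_mul_left this (inv_pos.2 hgpos))
    rw [hcard] at this
    have h2 := mul_le_mul_of_nonneg_left hPtot hmpos.le
    refine le_of_mul_le_mul_left (this.trans (h2.trans_eq ?_)) hgpos
    ring
  have hPU : ∑ i ∈ Sm \ S, P i ≤ 2 * m * V :=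
    (Finset.sum_le_sum_of_subset_of_nonneg Finset.sdiff_subset fun i _ _ => hP0 i).trans hPSm
  -- each selected outsider is close to the mean
  have hpt : ∀ i, √q * ‖x i - c‖ ≤ √(P i) + √V := by
    intro i
    set T := N (x i) ∩ S with hT
    have hTc : q ≤ T.card := by
      have h1 := (hN (x i)).1
      have h2 := Finset.card_union_add_card_inter (N (x i)) S
      have h3 : (N (x i) ∪ S).card ≤ n := by
        simpa using Finset.card_le_univ (N (x i) ∪ S)
      have h4 : n ≤ T.card + 2 * f := by rw [hT]; omega
      have h5 : (n : ℝ) ≤ T.card + 2 * f := by exact_mod_cast h4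
      linarith
    have hTpos : (0 : ℝ) < T.card := hq.trans_le hTc
    have s1 : (T.card : ℝ) * ‖x i - c‖ ≤ ∑ j ∈ T, ‖x i - x j‖ + ∑ j ∈ T, ‖x j - c‖ := by
      rw [← Finset.sum_add_distrib, ← nsmul_eq_mul]
      exact Finset.card_nsmul_le_sum _ _ _ fun j _ => norm_sub_le_norm_sub_add_norm_sub _ _ _
    have s2 := mk_cs T (fun j => ‖x i - x j‖)
    have s3 := mk_cs T (fun j => ‖x j - c‖)
    have s4 : √(∑ j ∈ T, ‖x i - x j‖ ^ 2) ≤ √(P i) := Real.sqrt_le_sqrt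
      (Finset.sum_le_sum_of_subset_of_nonneg Finset.inter_subset_left fun _ _ _ => by positivity)
    have s5 : √(∑ j ∈ T, ‖x j - c‖ ^ 2) ≤ √V := Real.sqrt_le_sqrt
      (Finset.sum_le_sum_of_subset_of_nonneg Finset.inter_subset_right fun _ _ _ => by positivity)
    have hst : 0 < √(T.card : ℝ) := Real.sqrt_pos.2 hTpos
    have s6 := mul_le_mul_of_nonneg_left (add_le_add s4 s5) hst.le
    have s7 : √(T.card : ℝ) * ‖x i - c‖ ≤ √(P i) + √V := by
      refine le_of_mul_le_mul_left ?_ hst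
      rw [← mul_assoc, Real.mul_self_sqrt hTpos.le]
      linarith
    exact (mul_le_mul_of_nonneg_right (Real.sqrt_le_sqrt hTc) (norm_nonneg _)).trans s7
  have hsq : 0 < √q := Real.sqrt_pos.2 hq
  set u : ℝ := ((Sm \ S).card : ℝ) with hu
  set v : ℝ := ((Sm ∩ S).card : ℝ) with hv
  have hu0 : 0 ≤ u := Nat.cast_nonneg _
  have hU : ∑ i ∈ Sm \ S, ‖x i - c‖ ≤ (√(2 * m) + √u) * √(u / q) * √V := by
    have t1 : √q * ∑ i ∈ Sm \ S, ‖x i - c‖ ≤ ∑ i ∈ Sm \ S, √(P i) + u * √V := by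
      rw [Finset.mul_sum, hu, ← nsmul_eq_mul, ← Finset.sum_const, ← Finset.sum_add_distrib]
      exact Finset.sum_le_sum fun i _ => hpt i
    have t2 := mk_cs (Sm \ S) (fun i => √(P i))
    simp only [Real.sq_sqrt (hP0 _)] at t2
    have t3 : √(∑ i ∈ Sm \ S, P i) ≤ √(2 * m) * √V := by
      rw [← Real.sqrt_mul (by positivity)]
      exact Real.sqrt_le_sqrt hPU
    have t4 := mul_le_mul_of_nonneg_left t3 (Real.sqrt_nonneg u)
    refine le_of_mul_le_mul_left ?_ hsq
    have e : √q * ((√(2 * m) + √u) * √(u / q) * √V) = √u * (√(2 * m) * √V) + u * √V := by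
      rw [Real.sqrt_div hu0]
      field_simp
      linear_combination √V * Real.mul_self_sqrt hu0
    rw [e]
    linarith
  have hI : ∑ i ∈ Sm ∩ S, ‖x i - c‖ ≤ √v * √V := by
    refine (mk_cs _ _).trans (mul_le_mul_of_nonneg_left (Real.sqrt_le_sqrt ?_) (Real.sqrt_nonneg _))
    exact Finset.sum_le_sum_of_subset_of_nonneg Finset.inter_subset_right
      fun _ _ _ => by positivity
  have hmean : meanVec x Sm - c = (m : ℝ)⁻¹ • ∑ i ∈ Sm, (x i - c) := by
    rw [Finset.sum_sub_distrib, Finset.sum_const, hcard, smul_sub, ← Nat.cast_smul_eq_nsmul ℝ,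
      smul_smul, inv_mul_cancel₀ hmpos.ne', one_smul, meanVec, hcard]
  have hnorm : ‖meanVec x Sm - c‖ ≤ (m : ℝ)⁻¹ * ((√v + (√(2 * m) + √u) * √(u / q)) * √V) := by
    rw [hmean, norm_smul, Real.norm_of_nonneg (inv_pos.2 hmpos).le]
    refine mul_le_mul_of_nonneg_left ((norm_sum_le _ _).trans ?_) (inv_pos.2 hmpos).le
    rw [← Finset.sum_inter_add_sum_sdiff Sm S]
    linarith
  refine (pow_le_pow_left₀ (norm_nonneg _) hnorm 2).trans_eq ?_
  rw [hvar, ← hg, mul_pow, mul_pow, Real.sq_sqrt hV0]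
  field_simp
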